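/- arXiv:2107.09555 — 7 statements merged into one kernel-verified Lean document; each statement's English description precedes it below -/
import Mathlib

section
/- For every natural number n ≥ 3, the inequality ∫_{-n}^{2} (2-t)^2 (n+t)^{n-1} (t+2n+2)^{n(n-1)/2} dt < 2 ∫_{-n}^{2} (2-t) (n+t)^{n-1} (t+2n+2)^{n(n-1)/2} dt holds, where both integrals are real integrals over the interval [-n, 2]. -/
/-- An antiderivative identity: up to a term that is positive on `(-n, 2)`, the function
`(n + 2) ^ 2 * (2 - (2 - t)) * (2 - t) * (n + t) ^ (n - 1) * (t + 2 * n + 2) ^ m` is the derivative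
of a function vanishing at `-n` and `2`; here `n = j + 1` and `m = k + 1`. -/
theorem hasDerivAt_weight_primitive (j k : ℕ) (n t : ℝ) (hn : n = j + 1) :
    HasDerivAt (fun t : ℝ => -((2 - t) ^ 2 * (n + t) ^ (j + 1) * (t + 2 * n + 2) ^ (k + 2) / 2
        + ((k : ℝ) + 4) / 6 * ((2 - t) ^ 3 * (n + t) ^ (j + 1) * (t + 2 * n + 2) ^ (k + 1))))
      ((n + 2) ^ 2 * (2 * ((2 - t) * (n + t) ^ j * (t + 2 * n + 2) ^ (k + 1))
          - (2 - t) ^ 2 * (n + t) ^ j * (t + 2 * n + 2) ^ (k + 1))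
        - (2 - t) ^ 3 * (n + t) ^ j * (t + 2 * n + 2) ^ k * ((k : ℝ) + 1) / 6
          * (((k : ℝ) + 4) * (n + t) + n * (t + 2 * n + 2))) t := by
  have hs : HasDerivAt (fun t : ℝ => 2 - t) (-1) t := (hasDerivAt_id t).const_sub 2
  have ha : HasDerivAt (fun t : ℝ => n + t) 1 t := (hasDerivAt_id t).const_add n
  have hb : HasDerivAt (fun t : ℝ => t + 2 * n + 2) 1 t :=
    ((hasDerivAt_id t).add_const (2 * n)).add_const 2
  have h₁ := (((hs.fun_pow 2).fun_mul (ha.fun_pow (j + 1))).fun_mul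
    (hb.fun_pow (k + 2))).div_const 2
  have h₂ := (((hs.fun_pow 3).fun_mul (ha.fun_pow (j + 1))).fun_mul
    (hb.fun_pow (k + 1))).const_mul (((k : ℝ) + 4) / 6)
  refine (h₁.fun_add h₂).fun_neg.congr_deriv ?_
  have hj : (j : ℝ) = n - 1 := by linarith
  simp only [Nat.add_sub_cancel, show k + 2 - 1 = k + 1 from rfl]
  push_cast
  rw [hj]
  ring

theorem integral_sq_mul_weight_lt (j k : ℕ) (n : ℝ) (hn : n = j + 1) :
    (∫ t in (-n)..2, (2 - t) ^ 2 * (n + t) ^ j * (t + 2 * n + 2) ^ (k + 1)) <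
      2 * ∫ t in (-n)..2, (2 - t) * (n + t) ^ j * (t + 2 * n + 2) ^ (k + 1) := by
  have hn0 : 0 < n := by rw [hn]; positivity
  have hFTC := intervalIntegral.integral_eq_sub_of_hasDerivAt (a := -n) (b := 2)
    (fun t _ => hasDerivAt_weight_primitive j k n t hn)
    (Continuous.intervalIntegrable (by fun_prop) _ _)
  have hpos : 0 < ∫ t in (-n)..2, (2 - t) ^ 3 * (n + t) ^ j * (t + 2 * n + 2) ^ k
      * ((k : ℝ) + 1) / 6 * (((k : ℝ) + 4) * (n + t) + n * (t + 2 * n + 2)) := by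
    refine intervalIntegral.intervalIntegral_pos_of_pos_on
      (Continuous.intervalIntegrable (by fun_prop) _ _) (fun t ht => ?_) (by linarith)
    have hs : 0 < 2 - t := by linarith [ht.2]
    have ha : 0 < n + t := by linarith [ht.1]
    have hb : 0 < t + 2 * n + 2 := by linarith
    positivity
  rw [intervalIntegral.integral_sub (Continuous.intervalIntegrable (by fun_prop) _ _)
      (Continuous.intervalIntegrable (by fun_prop) _ _),
    intervalIntegral.integral_const_mul,
    intervalIntegral.integral_sub (Continuous.intervalIntegrable (by fun_prop) _ _)
      (Continuous.intervalIntegrable (by fun_prop) _ _),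
    intervalIntegral.integral_const_mul] at hFTC
  simp only [sub_self, add_neg_cancel, ne_eq, OfNat.ofNat_ne_zero, not_false_eq_true, zero_pow,
    Nat.add_eq_zero_iff, one_ne_zero, and_false, zero_mul, mul_zero, zero_div, add_zero,
    neg_zero] at hFTC
  rw [sub_eq_zero] at hFTC
  rw [← hFTC] at hpos
  exact sub_pos.mp (pos_of_mul_pos_right hpos (by positivity))

theorem stmt_0 (n : ℕ) (hn : 3 ≤ n) :
    (∫ t in (-(n : ℝ))..2, (2 - t)^2 * ((n : ℝ) + t)^(n - 1) * (t + 2*(n : ℝ) + 2)^(n*(n-1)/2)) <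
    2 * ∫ t in (-(n : ℝ))..2, (2 - t) * ((n : ℝ) + t)^(n - 1) * (t + 2*(n : ℝ) + 2)^(n*(n-1)/2) := by
  have hm : 1 ≤ n * (n - 1) / 2 := by
    rw [Nat.le_div_iff_mul_le two_pos]
    exact (by norm_num : 1 * 2 ≤ 3 * 2).trans (Nat.mul_le_mul hn (by omega))
  obtain ⟨k, hk⟩ := Nat.exists_eq_add_of_le' hm
  rw [hk]
  exact integral_sq_mul_weight_lt (n - 1) k n (by rw [Nat.cast_pred (by omega)]; ring)
end

section
/- For every natural number n ≥ 3, the integral ∫_{-n}^{2} t (2-t) (n+t)^{n-1} (t+2n+2)^{n(n-1)/2} dt is strictly positive. -/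
theorem integral_mul_two_sub_mul_add_pow_eq_zero {n : ℕ} (hn : n ≠ 0) :
    ∫ t in (-(n : ℝ))..2, t * (2 - t) * ((n : ℝ) + t) ^ (n - 1) = 0 := by
  have hderiv : ∀ t ∈ Set.uIcc (-(n : ℝ)) 2,
      HasDerivAt (fun t : ℝ => -(((n : ℝ) + t) ^ n * (2 - t) ^ 2) / (n + 2))
        (t * (2 - t) * ((n : ℝ) + t) ^ (n - 1)) t := by
    intro t _
    have h := (((((hasDerivAt_id t).const_add (n : ℝ)).pow n).mul
      (((hasDerivAt_id t).const_sub 2).pow 2)).neg).div_const ((n : ℝ) + 2)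
    refine h.congr_deriv ?_
    obtain ⟨k, rfl⟩ := Nat.exists_eq_succ_of_ne_zero hn
    have : ((k + 1 : ℕ) : ℝ) + 2 ≠ 0 := by positivity
    simp only [Nat.succ_eq_add_one, Nat.add_sub_cancel, id, Pi.pow_apply] at this ⊢
    field_simp
    push_cast
    ring
  rw [intervalIntegral.integral_eq_sub_of_hasDerivAt hderiv
    (Continuous.intervalIntegrable (by fun_prop) _ _)]
  simp [hn]

theorem stmt_1 (n : ℕ) (hn : 3 ≤ n) :
    0 < ∫ t in (-(n : ℝ))..2, t * (2 - t) * ((n : ℝ) + t)^(n - 1) * (t + 2*(n : ℝ) + 2)^(n*(n-1)/2) := by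
  have hm : n * (n - 1) / 2 ≠ 0 := by
    have : 3 * 2 ≤ n * (n - 1) := Nat.mul_le_mul hn (by omega)
    omega
  generalize n * (n - 1) / 2 = m at hm ⊢
  set c : ℝ := (2 * (n : ℝ) + 2) ^ m
  have hn0 : (0 : ℝ) < n := by exact_mod_cast (by omega : 0 < n)
  have hsplit : ∫ t in (-(n : ℝ))..2,
        t * (2 - t) * ((n : ℝ) + t) ^ (n - 1) * (t + 2 * (n : ℝ) + 2) ^ m =
      ∫ t in (-(n : ℝ))..2,
        t * (2 - t) * ((n : ℝ) + t) ^ (n - 1) * ((t + 2 * (n : ℝ) + 2) ^ m - c) := by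
    simp_rw [mul_sub _ _ c]
    rw [intervalIntegral.integral_sub (Continuous.intervalIntegrable (by fun_prop) _ _)
      (Continuous.intervalIntegrable (by fun_prop) _ _), intervalIntegral.integral_mul_const,
      integral_mul_two_sub_mul_add_pow_eq_zero (by omega), zero_mul, sub_zero]
  rw [hsplit]
  refine intervalIntegral.integral_pos (by linarith) (by fun_prop) ?_
    ⟨1, ⟨by linarith, by norm_num⟩, ?_⟩
  · rintro t ⟨ht, ht2⟩
    have hw : 0 ≤ (2 - t) * ((n : ℝ) + t) ^ (n - 1) :=
      mul_nonneg (by linarith) (pow_nonneg (by linarith) _)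
    have hmono : 0 ≤ t * ((t + 2 * (n : ℝ) + 2) ^ m - c) := by
      rcases le_total 0 t with h | h
      · exact mul_nonneg h (sub_nonneg.2 (pow_le_pow_left₀ (by linarith) (by linarith) m))
      · exact mul_nonneg_of_nonpos_of_nonpos h
          (sub_nonpos.2 (pow_le_pow_left₀ (by linarith) (by linarith) m))
    calc 0 ≤ (2 - t) * ((n : ℝ) + t) ^ (n - 1) * (t * ((t + 2 * (n : ℝ) + 2) ^ m - c)) :=
          mul_nonneg hw hmono
      _ = _ := by ring
  · have h : c < (1 + 2 * (n : ℝ) + 2) ^ m :=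
      pow_lt_pow_left₀ (by linarith) (by linarith) hm
    exact mul_pos (mul_pos (by norm_num) (by positivity)) (sub_pos.2 h)
end

section
/- For all natural numbers n > k ≥ 2, the inequality ∫_{-k}^{2n-2k+2} (k+t)^k (2n-2k+2-t)^{2n-2k+1} (4n-3k+4-t)^{k-1} dt < k · ∫_{-k}^{2n-2k+2} (k+t)^{k-1} (2n-2k+2-t)^{2n-2k+1} (4n-3k+4-t)^{k-1} dt holds. -/
open intervalIntegral in
theorem integral_sq_sub_sq_pow_succ (L : ℝ) (p q : ℕ) :
    ∫ y in (0 : ℝ)..L, (L ^ 2 - y ^ 2) ^ (q + 1) * y ^ p =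
      L ^ 2 * (∫ y in (0 : ℝ)..L, (L ^ 2 - y ^ 2) ^ q * y ^ p) -
        ∫ y in (0 : ℝ)..L, (L ^ 2 - y ^ 2) ^ q * y ^ (p + 2) := by
  rw [← integral_const_mul, ← integral_sub]
  · congr 1
    ext y
    ring
  all_goals exact Continuous.intervalIntegrable (by fun_prop) _ _

theorem integral_sq_sub_sq_pow_succ_mul (L : ℝ) (p q : ℕ) :
    (p + 2 * q + 3) * (∫ y in (0 : ℝ)..L, (L ^ 2 - y ^ 2) ^ (q + 1) * y ^ p) =
      L ^ 2 * (2 * q + 2) * ∫ y in (0 : ℝ)..L, (L ^ 2 - y ^ 2) ^ q * y ^ p := by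
  induction q generalizing p with
  | zero =>
    rw [integral_sq_sub_sq_pow_succ]
    simp only [pow_zero, one_mul, integral_pow]
    push_cast
    have h₁ : (p : ℝ) + 1 ≠ 0 := by positivity
    have h₃ : (p : ℝ) + 2 + 1 ≠ 0 := by positivity
    simp only [ne_eq, Nat.add_eq_zero_iff, one_ne_zero, and_false, not_false_eq_true, zero_pow]
    field_simp
    ring
  | succ q ih =>
    have hp := ih p
    have hp₂ := ih (p + 2)
    rw [integral_sq_sub_sq_pow_succ L p (q + 1)]
    rw [integral_sq_sub_sq_pow_succ L p q] at hp ⊢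
    push_cast at hp₂ ⊢
    linear_combination L ^ 2 * hp - hp₂

theorem integral_sq_sub_sq_pow_pos {L : ℝ} (hL : 0 < L) (p q : ℕ) :
    0 < ∫ y in (0 : ℝ)..L, (L ^ 2 - y ^ 2) ^ q * y ^ p := by
  refine intervalIntegral.intervalIntegral_pos_of_pos_on
    (Continuous.intervalIntegrable (by fun_prop) _ _) (fun y hy => ?_) hL
  have : 0 < L ^ 2 - y ^ 2 := sub_pos.2 (pow_lt_pow_left₀ hy.2 hy.1.le two_ne_zero)
  have := hy.1
  positivity

theorem integral_sq_sub_sq_pow_step {L : ℝ} (hL : 0 < L) (p q : ℕ)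
    (h : (p + 1) * L * (∫ y in (0 : ℝ)..L, (L ^ 2 - y ^ 2) ^ q * y ^ p) ≤
      (p + q + 2) * ∫ y in (0 : ℝ)..L, (L ^ 2 - y ^ 2) ^ q * y ^ (p + 1)) :
    (p + 1) * L * (∫ y in (0 : ℝ)..L, (L ^ 2 - y ^ 2) ^ (q + 1) * y ^ p) <
      (p + q + 3) * ∫ y in (0 : ℝ)..L, (L ^ 2 - y ^ 2) ^ (q + 1) * y ^ (p + 1) := by
  have e₀ := integral_sq_sub_sq_pow_succ_mul L p q
  have e₁ := integral_sq_sub_sq_pow_succ_mul L (p + 1) q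
  have h₁ := integral_sq_sub_sq_pow_pos hL (p + 1) q
  push_cast at e₁
  set A := ∫ y in (0 : ℝ)..L, (L ^ 2 - y ^ 2) ^ q * y ^ p
  set B := ∫ y in (0 : ℝ)..L, (L ^ 2 - y ^ 2) ^ q * y ^ (p + 1)
  have c₀ : (0 : ℝ) < p + 2 * q + 3 := by positivity
  have c₁ : (0 : ℝ) < p + 1 + 2 * q + 3 := by positivity
  rw [mul_comm, ← eq_div_iff c₀.ne'] at e₀
  rw [mul_comm, ← eq_div_iff c₁.ne'] at e₁
  rw [e₀, e₁, ← mul_div_assoc, ← mul_div_assoc, div_lt_div_iff₀ c₀ c₁]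
  have hc : 0 < L ^ 2 * (2 * q + 2 : ℝ) := by positivity
  have key : (p + 1) * L * A * (p + 1 + 2 * q + 3) < (p + q + 3) * B * (p + 2 * q + 3) := by
    refine (mul_le_mul_of_nonneg_right h c₁.le).trans_lt ?_
    have : 0 < B * (q + 1) := by positivity
    linarith
  linarith [mul_lt_mul_of_pos_left key hc]

theorem integral_sq_sub_sq_pow_le {L : ℝ} (hL : 0 < L) (p q : ℕ) :
    (p + 1) * L * (∫ y in (0 : ℝ)..L, (L ^ 2 - y ^ 2) ^ q * y ^ p) ≤
      (p + q + 2) * ∫ y in (0 : ℝ)..L, (L ^ 2 - y ^ 2) ^ q * y ^ (p + 1) := by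
  induction q with
  | zero =>
    have h₁ : (p : ℝ) + 1 ≠ 0 := by positivity
    have h₂ : (p : ℝ) + 1 + 1 ≠ 0 := by positivity
    simp only [pow_zero, one_mul, integral_pow]
    push_cast
    simp only [ne_eq, Nat.add_eq_zero_iff, one_ne_zero, and_false, not_false_eq_true, zero_pow]
    apply le_of_eq
    field_simp
    ring
  | succ q ih =>
    have h := (integral_sq_sub_sq_pow_step hL p q ih).le
    push_cast
    linear_combination h

theorem stmt_9 (n k : ℕ) (hk : 2 ≤ k) (hnk : k < n) :
    (∫ t in (-(k : ℝ))..(2*(n : ℝ) - 2*(k : ℝ) + 2),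
        ((k : ℝ) + t)^k * (2*(n : ℝ) - 2*(k : ℝ) + 2 - t)^(2*n - 2*k + 1) *
          (4*(n : ℝ) - 3*(k : ℝ) + 4 - t)^(k - 1)) <
    (k : ℝ) * ∫ t in (-(k : ℝ))..(2*(n : ℝ) - 2*(k : ℝ) + 2),
        ((k : ℝ) + t)^(k - 1) * (2*(n : ℝ) - 2*(k : ℝ) + 2 - t)^(2*n - 2*k + 1) *
          (4*(n : ℝ) - 3*(k : ℝ) + 4 - t)^(k - 1) := by
  obtain ⟨q, rfl⟩ := Nat.exists_eq_add_of_le' hk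
  obtain ⟨p, hp⟩ : ∃ p, 2 * n - 2 * (q + 2) + 1 = p := ⟨_, rfl⟩
  have hb : 2 * (n : ℝ) - 2 * ((q + 2 : ℕ) : ℝ) + 2 = p + 1 := by
    have : 2 * n + 1 = p + 2 * (q + 2) := by lia
    have : 2 * (n : ℝ) + 1 = p + 2 * (q + 2) := mod_cast this
    push_cast
    linarith
  have hc : 4 * (n : ℝ) - 3 * ((q + 2 : ℕ) : ℝ) + 4 = 2 * (p + 1) + (q + 2 : ℕ) := by linarith
  rw [hb, hc, hp, show q + 2 - 1 = q + 1 from rfl]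
  set L : ℝ := p + q + 3 with hL
  have hL₀ : 0 < L := by positivity
  have hlim : (p + 1 : ℝ) - -((q + 2 : ℕ) : ℝ) = L := by push_cast; ring
  have hsubst (f : ℝ → ℝ) : ∫ t in (-((q + 2 : ℕ) : ℝ))..(p + 1), f (p + 1 - t) =
      ∫ y in (0 : ℝ)..L, f y := by
    rw [intervalIntegral.integral_comp_sub_left, sub_self, hlim]
  have e₁ := hsubst fun y => L * ((L ^ 2 - y ^ 2) ^ (q + 1) * y ^ p) -
    (L ^ 2 - y ^ 2) ^ (q + 1) * y ^ (p + 1)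
  have e₂ := hsubst fun y => (L ^ 2 - y ^ 2) ^ (q + 1) * y ^ p
  have hfactor (t : ℝ) : L ^ 2 - (p + 1 - t) ^ 2 =
      (((q + 2 : ℕ) : ℝ) + t) * (2 * (p + 1) + (q + 2 : ℕ) - t) := by
    rw [hL]; push_cast; ring
  have hleft (t : ℝ) : ((q + 2 : ℕ) : ℝ) + t = L - (p + 1 - t) := by
    rw [hL]; push_cast; ring
  have hsub : (∫ y in (0 : ℝ)..L, (L * ((L ^ 2 - y ^ 2) ^ (q + 1) * y ^ p) -
      (L ^ 2 - y ^ 2) ^ (q + 1) * y ^ (p + 1))) =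
      L * (∫ y in (0 : ℝ)..L, (L ^ 2 - y ^ 2) ^ (q + 1) * y ^ p) -
        ∫ y in (0 : ℝ)..L, (L ^ 2 - y ^ 2) ^ (q + 1) * y ^ (p + 1) := by
    rw [intervalIntegral.integral_sub (Continuous.intervalIntegrable (by fun_prop) _ _)
      (Continuous.intervalIntegrable (by fun_prop) _ _), intervalIntegral.integral_const_mul]
  calc
    _ = _ := by
      refine Eq.trans ?_ (e₁.trans hsub)
      congr 1
      ext t
      rw [hfactor, mul_pow, pow_succ (((q + 2 : ℕ) : ℝ) + t) (q + 1)]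
      linear_combination (((q + 2 : ℕ) : ℝ) + t) ^ (q + 1) * (p + 1 - t) ^ p *
        (2 * (p + 1) + (q + 2 : ℕ) - t) ^ (q + 1) * hleft t
    _ < (q + 2 : ℕ) * ∫ y in (0 : ℝ)..L, (L ^ 2 - y ^ 2) ^ (q + 1) * y ^ p := by
      have h := integral_sq_sub_sq_pow_step hL₀ p q (integral_sq_sub_sq_pow_le hL₀ p q)
      rw [← hL, mul_comm _ L, mul_assoc] at h
      have h := lt_of_mul_lt_mul_left h hL₀.le
      have hL' : L = (p + 1) + (q + 2 : ℕ) := by rw [hL]; push_cast; ring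
      linear_combination h + (∫ y in (0 : ℝ)..L, (L ^ 2 - y ^ 2) ^ (q + 1) * y ^ p) * hL'
    _ = _ := by
      rw [← e₂]
      congr 1
      congr 1
      ext t
      rw [hfactor, mul_pow]
      ring
end

section
/- For all natural numbers ℓ ≥ 1 and n ≥ ℓ + 2, the inequality (n + ℓ + 2) ∫_0^1 (1-s^2)^n ds > 2^{2ℓ+1} · ℓ! · (ℓ+1)! / (2ℓ+1)! holds. -/
theorem integral_one_sub_sq_pow_succ (n : ℕ) :
    (2 * (n : ℝ) + 3) * ∫ s in (0:ℝ)..1, (1 - s^2)^(n+1) =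
      (2 * (n : ℝ) + 2) * ∫ s in (0:ℝ)..1, (1 - s^2)^n := by
  have hderiv : ∀ x ∈ Set.uIcc (0:ℝ) 1, HasDerivAt (fun s : ℝ => s * (1 - s^2)^(n+1))
      ((2 * (n : ℝ) + 3) * (1 - x^2)^(n+1) - (2 * (n : ℝ) + 2) * (1 - x^2)^n) x := by
    intro x _
    have h : HasDerivAt (fun s : ℝ => s * (1 - s^2)^(n+1)) _ x :=
      (hasDerivAt_id' x).fun_mul ((((hasDerivAt_id' x).fun_pow 2).const_sub 1).fun_pow (n+1))
    refine h.congr_deriv ?_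
    simp only [Nat.add_sub_cancel]
    push_cast
    ring
  have hint := intervalIntegral.integral_eq_sub_of_hasDerivAt hderiv
    (Continuous.intervalIntegrable (by fun_prop) _ _)
  rw [intervalIntegral.integral_sub (Continuous.intervalIntegrable (by fun_prop) _ _)
    (Continuous.intervalIntegrable (by fun_prop) _ _),
    intervalIntegral.integral_const_mul, intervalIntegral.integral_const_mul] at hint
  norm_num at hint
  linarith

theorem integral_one_sub_sq_pow (n : ℕ) :
    ∫ s in (0:ℝ)..1, (1 - s^2)^n =
      (2:ℝ)^(2*n) * (n.factorial : ℝ)^2 / ((2*n+1).factorial : ℝ) := by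
  induction n with
  | zero => simp
  | succ n ih =>
    have h := integral_one_sub_sq_pow_succ n
    rw [ih] at h
    have hpos : (0:ℝ) < 2 * (n : ℝ) + 3 := by positivity
    apply mul_left_cancel₀ hpos.ne'
    rw [h, show 2 * (n + 1) + 1 = (2 * n + 1) + 1 + 1 by ring, Nat.factorial_succ (2 * n + 1 + 1),
      Nat.factorial_succ (2 * n + 1), Nat.factorial_succ n]
    push_cast
    have hfac : ((2 * n + 1).factorial : ℝ) ≠ 0 := by positivity
    have h₂ : 2 * (n : ℝ) + 1 + 1 ≠ 0 := by positivity
    have h₃ : 2 * (n : ℝ) + 1 + 1 + 1 ≠ 0 := by positivity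
    field_simp
    ring

theorem add_mul_integral_one_sub_sq_pow_succ (l n : ℕ) :
    ((n : ℝ) + l + 3) * ∫ s in (0:ℝ)..1, (1 - s^2)^(n+1) =
      ((n : ℝ) + l + 2) * (∫ s in (0:ℝ)..1, (1 - s^2)^n) +
        ((n : ℝ) - l) / (2 * n + 3) * ∫ s in (0:ℝ)..1, (1 - s^2)^n := by
  have hpos : (0:ℝ) < 2 * (n : ℝ) + 3 := by positivity
  have h := integral_one_sub_sq_pow_succ n
  field_simp
  linear_combination ((n : ℝ) + l + 3) * h

theorem stmt_10 (l n : ℕ) (hl : 1 ≤ l) (hn : l + 2 ≤ n) :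
    (2:ℝ)^(2*l+1) * (Nat.factorial l : ℝ) * (Nat.factorial (l+1) : ℝ) /
        (Nat.factorial (2*l+1) : ℝ) <
      ((n : ℝ) + (l : ℝ) + 2) * ∫ s in (0:ℝ)..1, (1 - s^2)^n := by
  have hpos (m : ℕ) : 0 < ∫ s in (0:ℝ)..1, (1 - s^2)^m := by
    rw [integral_one_sub_sq_pow]
    positivity
  have hlt (m : ℕ) (hm : l < m) :
      ((m : ℝ) + l + 2) * (∫ s in (0:ℝ)..1, (1 - s^2)^m) <
        (((m + 1 : ℕ) : ℝ) + l + 2) * ∫ s in (0:ℝ)..1, (1 - s^2)^(m+1) := by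
    have h := add_mul_integral_one_sub_sq_pow_succ l m
    have hml : (0:ℝ) < (m : ℝ) - l := sub_pos.mpr (by exact_mod_cast hm)
    have hgain : 0 < ((m : ℝ) - l) / (2 * m + 3) * ∫ s in (0:ℝ)..1, (1 - s^2)^m :=
      mul_pos (by positivity) (hpos m)
    push_cast
    linarith
  have hstart : (2:ℝ)^(2*l+1) * (Nat.factorial l : ℝ) * (Nat.factorial (l+1) : ℝ) /
      (Nat.factorial (2*l+1) : ℝ) =
        (((l + 1 : ℕ) : ℝ) + l + 2) * ∫ s in (0:ℝ)..1, (1 - s^2)^(l+1) := by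
    have h := add_mul_integral_one_sub_sq_pow_succ l l
    rw [sub_self, zero_div, zero_mul, add_zero, integral_one_sub_sq_pow l] at h
    rw [show (((l + 1 : ℕ) : ℝ) + l + 2) = (l : ℝ) + l + 3 by push_cast; ring, h,
      Nat.factorial_succ l]
    push_cast
    ring
  rw [hstart]
  induction n, hn using Nat.le_induction with
  | base => exact hlt (l + 1) (Nat.lt_succ_self l)
  | succ m hm ih => exact ih.trans (hlt m (by omega))
end

section
/- The sequence of real numbers R_n := n · (∫_{-n}^{2} (2-t)(n+t)^{n-1}(t+2n+2)^{n(n-1)/2} dt) / (∫_{-n}^{2} (2-t)(n+t)^{n}(t+2n+2)^{n(n-1)/2} dt), indexed by natural numbers n ≥ 3, converges to 1 as n tends to infinity. -/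
/-- The integral `∫ (b - t) (a + t)^k (t + c)^m` over `[-a, b]`. -/
noncomputable def weightedMoment (a b c : ℝ) (m k : ℕ) : ℝ :=
  ∫ t in (-a)..b, (b - t) * (a + t) ^ k * (t + c) ^ m

lemma weightedMoment_pos {a b c : ℝ} (hab : -a < b) (hac : a ≤ c) (m k : ℕ) :
    0 < weightedMoment a b c m k := by
  refine intervalIntegral.intervalIntegral_pos_of_pos_on ?_ ?_ hab
  · exact Continuous.intervalIntegrable (by fun_prop) _ _
  · rintro t ⟨h₁, h₂⟩
    have h₃ : 0 < b - t := by linarith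
    have h₄ : 0 < a + t := by linarith
    have h₅ : 0 < t + c := by linarith
    positivity

lemma weightedMoment_succ_le {a b c : ℝ} (hab : -a < b) (hac : a ≤ c) (m k : ℕ) :
    weightedMoment a b c m (k + 1) ≤ (a + b) * weightedMoment a b c m k := by
  unfold weightedMoment
  rw [← intervalIntegral.integral_const_mul]
  refine intervalIntegral.integral_mono_on hab.le
    (Continuous.intervalIntegrable (by fun_prop) _ _)
    (Continuous.intervalIntegrable (by fun_prop) _ _) ?_
  rintro t ⟨h₁, h₂⟩
  have h₃ : 0 ≤ b - t := by linarith
  have h₄ : 0 ≤ a + t := by linarith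
  have h₅ : 0 ≤ t + c := by linarith
  have h : 0 ≤ (b - t) ^ 2 * (a + t) ^ k * (t + c) ^ m := by positivity
  linear_combination h

/-- Integrating the derivative of `(b - t)^2 (a + t)^(k + 1) (t + c)^m` over `[-a, b]` bounds
a moment by the next one. -/
lemma weightedMoment_le_succ {a b c : ℝ} (hab : -a < b) (hac : a ≤ c) (m k : ℕ) :
    (k + 1) * (a + b) * weightedMoment a b c m k ≤ (k + 3) * weightedMoment a b c m (k + 1) := by
  have hderiv (t : ℝ) : HasDerivAt (fun t => (b - t) ^ 2 * (a + t) ^ (k + 1) * (t + c) ^ m)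
      (-2 * (b - t) * (a + t) ^ (k + 1) * (t + c) ^ m
        + (k + 1) * (b - t) ^ 2 * (a + t) ^ k * (t + c) ^ m
        + m * (b - t) ^ 2 * (a + t) ^ (k + 1) * (t + c) ^ (m - 1)) t := by
    have h₁ := ((hasDerivAt_id t).const_sub b).pow 2
    have h₂ := ((hasDerivAt_id t).const_add a).pow (k + 1)
    have h₃ := ((hasDerivAt_id t).add_const c).pow m
    refine ((h₁.mul h₂).mul h₃).congr_deriv ?_
    simp
    ring
  have hint := intervalIntegral.integral_eq_sub_of_hasDerivAt (a := -a) (b := b)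
    (fun t _ => hderiv t) (Continuous.intervalIntegrable (by fun_prop) _ _)
  have hzero : (b - b) ^ 2 * (a + b) ^ (k + 1) * (b + c) ^ m
      - (b - -a) ^ 2 * (a + -a) ^ (k + 1) * (-a + c) ^ m = 0 := by simp
  rw [hzero] at hint
  rw [← sub_nonpos, ← hint]
  unfold weightedMoment
  rw [← intervalIntegral.integral_const_mul, ← intervalIntegral.integral_const_mul,
    ← intervalIntegral.integral_sub (Continuous.intervalIntegrable (by fun_prop) _ _)
      (Continuous.intervalIntegrable (by fun_prop) _ _)]
  refine intervalIntegral.integral_mono_on hab.le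
    (Continuous.intervalIntegrable (by fun_prop) _ _)
    (Continuous.intervalIntegrable (by fun_prop) _ _) ?_
  rintro t ⟨h₁, h₂⟩
  have h₃ : 0 ≤ b - t := by linarith
  have h₄ : 0 ≤ a + t := by linarith
  have h₅ : 0 ≤ t + c := by linarith
  have h : 0 ≤ m * (b - t) ^ 2 * (a + t) ^ (k + 1) * (t + c) ^ (m - 1) := by positivity
  linear_combination h

theorem stmt_12 :
    Filter.Tendsto
      (fun n : ℕ =>
        (n : ℝ) *
          (∫ t in (-(n : ℝ))..2,
              (2 - t) * ((n : ℝ) + t)^(n - 1) * (t + 2*(n : ℝ) + 2)^(n*(n-1)/2)) /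
          (∫ t in (-(n : ℝ))..2,
              (2 - t) * ((n : ℝ) + t)^n * (t + 2*(n : ℝ) + 2)^(n*(n-1)/2)))
      Filter.atTop (nhds 1) := by
  have hlower : Filter.Tendsto (fun n : ℕ => (n : ℝ) / ((n : ℝ) + 2)) Filter.atTop (nhds 1) :=
    tendsto_natCast_div_add_atTop 2
  have hbounds (n : ℕ) (hn : 1 ≤ n) :
      (n : ℝ) / (n + 2) ≤ n * weightedMoment n 2 (2 * n + 2) (n * (n - 1) / 2) (n - 1)
          / weightedMoment n 2 (2 * n + 2) (n * (n - 1) / 2) n ∧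
        n * weightedMoment n 2 (2 * n + 2) (n * (n - 1) / 2) (n - 1)
          / weightedMoment n 2 (2 * n + 2) (n * (n - 1) / 2) n ≤ 1 := by
    generalize n * (n - 1) / 2 = m
    have hn₀ : (0 : ℝ) ≤ n := n.cast_nonneg
    have hab : -(n : ℝ) < 2 := by linarith
    have hac : (n : ℝ) ≤ 2 * n + 2 := by linarith
    have hpos := weightedMoment_pos hab hac m n
    have h₁ := weightedMoment_succ_le hab hac m (n - 1)
    have h₂ := weightedMoment_le_succ hab hac m (n - 1)
    rw [Nat.sub_add_cancel hn] at h₁ h₂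
    push_cast [Nat.cast_sub hn] at h₂
    constructor
    · rw [div_le_div_iff₀ (by positivity) hpos]
      nlinarith
    · rw [div_le_one hpos]
      have h₃ : (0 : ℝ) < n + 2 := by positivity
      refine le_of_mul_le_mul_left ?_ h₃
      linarith
  simp only [weightedMoment, ← add_assoc] at hbounds
  refine tendsto_of_tendsto_of_tendsto_of_le_of_le' hlower tendsto_const_nhds ?_ ?_
  · filter_upwards [Filter.eventually_ge_atTop 1] with n hn using (hbounds n hn).1
  · filter_upwards [Filter.eventually_ge_atTop 1] with n hn using (hbounds n hn).2
end

section
/- For every fixed natural number k ≥ 2, the sequence of real numbers R_{n,k} := (2n-2k+2) · (∫_{-k}^{2n-2k+2} (k+t)^{k-1}(2n-2k+2-t)^{2n-2k+1}(4n-3k+4-t)^{k-1} dt) / (∫_{-k}^{2n-2k+2} (k+t)^{k-1}(2n-2k+2-t)^{2n-2k+2}(4n-3k+4-t)^{k-1} dt), indexed by natural numbers n > k, converges to 1 as n tends to infinity. -/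
theorem succ_mul_integral_sq_sub_sq_pow (L : ℝ) (p q : ℕ) :
    ((q : ℝ) + 1) * ∫ v in (0 : ℝ)..L, (L ^ 2 - v ^ 2) ^ (p + 1) * v ^ q =
      2 * ((p : ℝ) + 1) * ∫ v in (0 : ℝ)..L, (L ^ 2 - v ^ 2) ^ p * v ^ (q + 2) := by
  have hderiv : ∀ v ∈ Set.uIcc (0 : ℝ) L,
      HasDerivAt (fun v : ℝ => (L ^ 2 - v ^ 2) ^ (p + 1) * v ^ (q + 1))
        (((q : ℝ) + 1) * ((L ^ 2 - v ^ 2) ^ (p + 1) * v ^ q) -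
          2 * ((p : ℝ) + 1) * ((L ^ 2 - v ^ 2) ^ p * v ^ (q + 2))) v := by
    intro v _
    have h := ((((hasDerivAt_id v).pow 2).const_sub (L ^ 2)).pow (p + 1)).mul
      ((hasDerivAt_id v).pow (q + 1))
    refine h.congr_deriv ?_
    simp only [Pi.pow_apply, id_eq, Nat.add_sub_cancel]
    push_cast
    ring
  have hint := intervalIntegral.integral_eq_sub_of_hasDerivAt hderiv
    (Continuous.intervalIntegrable (by fun_prop) _ _)
  rw [intervalIntegral.integral_sub (Continuous.intervalIntegrable (by fun_prop) _ _)
    (Continuous.intervalIntegrable (by fun_prop) _ _),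
    intervalIntegral.integral_const_mul, intervalIntegral.integral_const_mul] at hint
  simp at hint
  linarith

theorem integral_sq_sub_sq_pow_mul_pow (L : ℝ) (p q : ℕ) :
    ∫ v in (0 : ℝ)..L, (L ^ 2 - v ^ 2) ^ p * v ^ q =
      (p.factorial : ℝ) * 2 ^ p * L ^ (2 * p + q + 1) /
        ∏ j ∈ Finset.range (p + 1), ((q : ℝ) + 1 + 2 * j) := by
  induction p generalizing q with
  | zero => simp [integral_pow]
  | succ p ih =>
    have h := succ_mul_integral_sq_sub_sq_pow L p q
    rw [ih (q + 2)] at h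
    have hq : (q : ℝ) + 1 ≠ 0 := by positivity
    rw [Finset.prod_range_succ']
    have hprod : ∏ j ∈ Finset.range (p + 1), ((q : ℝ) + 1 + 2 * ((j + 1 : ℕ) : ℝ)) =
        ∏ j ∈ Finset.range (p + 1), (((q + 2 : ℕ) : ℝ) + 1 + 2 * j) :=
      Finset.prod_congr rfl fun j _ => by push_cast; ring
    have hpos : ∏ j ∈ Finset.range (p + 1), (((q + 2 : ℕ) : ℝ) + 1 + 2 * j) ≠ 0 :=
      Finset.prod_ne_zero_iff.2 fun j _ => by positivity
    rw [hprod, ← mul_right_inj' hq, h, Nat.factorial_succ]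
    field_simp
    push_cast
    ring

theorem integral_reflected_pow_mul_pow_mul_pow (k M : ℝ) (p q : ℕ) :
    ∫ t in (-k)..M, (k + t) ^ p * (M - t) ^ q * (2 * M + k - t) ^ p =
      ∫ v in (0 : ℝ)..(M + k), ((M + k) ^ 2 - v ^ 2) ^ p * v ^ q := by
  have h := intervalIntegral.integral_comp_sub_left (a := -k) (b := M)
    (fun v : ℝ => ((M + k) ^ 2 - v ^ 2) ^ p * v ^ q) M
  rw [sub_self, sub_neg_eq_add] at h
  rw [← h]
  congr 1 with t
  rw [show (M + k) ^ 2 - (M - t) ^ 2 = (k + t) * (2 * M + k - t) by ring, mul_pow]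
  ring

theorem tendsto_affine_ratio (a b : ℝ) :
    Filter.Tendsto (fun d : ℕ => (2 * (d : ℝ) + a) / (2 * (d : ℝ) + b)) Filter.atTop (nhds 1) := by
  have h := tendsto_add_mul_div_add_mul_atTop_nhds a b (2 : ℝ) (d := 2) two_ne_zero
  simpa [add_comm] using h

theorem stmt_14 (k : ℕ) (hk : 2 ≤ k) :
    Filter.Tendsto
      (fun n : ℕ =>
        (2*(n : ℝ) - 2*(k : ℝ) + 2) *
          (∫ t in (-(k : ℝ))..(2*(n : ℝ) - 2*(k : ℝ) + 2),
              ((k : ℝ) + t)^(k - 1) * (2*(n : ℝ) - 2*(k : ℝ) + 2 - t)^(2*n - 2*k + 1) *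
                (4*(n : ℝ) - 3*(k : ℝ) + 4 - t)^(k - 1)) /
          (∫ t in (-(k : ℝ))..(2*(n : ℝ) - 2*(k : ℝ) + 2),
              ((k : ℝ) + t)^(k - 1) * (2*(n : ℝ) - 2*(k : ℝ) + 2 - t)^(2*n - 2*k + 2) *
                (4*(n : ℝ) - 3*(k : ℝ) + 4 - t)^(k - 1)))
      Filter.atTop (nhds 1) := by
  rw [← Filter.tendsto_add_atTop_iff_nat k]
  obtain ⟨p, rfl⟩ : ∃ p, k = p + 1 := ⟨k - 1, by omega⟩
  have hlim : Filter.Tendsto (fun d : ℕ =>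
      (2 * (d : ℝ) + 2) / (2 * (d : ℝ) + (2 + ((p + 1 : ℕ) : ℝ))) *
        ∏ j ∈ Finset.range (p + 1),
          (2 * (d : ℝ) + (3 + 2 * (j : ℝ))) / (2 * (d : ℝ) + (2 + 2 * (j : ℝ))))
      Filter.atTop (nhds 1) := by
    simpa using (tendsto_affine_ratio 2 (2 + ((p + 1 : ℕ) : ℝ))).mul
      (tendsto_finsetProd (Finset.range (p + 1)) fun j _ =>
        tendsto_affine_ratio (3 + 2 * (j : ℝ)) (2 + 2 * (j : ℝ)))
  refine hlim.congr fun d => ?_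
  have hM : 2 * ((d + (p + 1) : ℕ) : ℝ) - 2 * ((p + 1 : ℕ) : ℝ) + 2 = 2 * (d : ℝ) + 2 := by
    push_cast; ring
  have hN : 4 * ((d + (p + 1) : ℕ) : ℝ) - 3 * ((p + 1 : ℕ) : ℝ) + 4 =
      2 * (2 * (d : ℝ) + 2) + ((p + 1 : ℕ) : ℝ) := by
    push_cast; ring
  have hexp : 2 * (d + (p + 1)) - 2 * (p + 1) = 2 * d := by omega
  rw [hM, hN, hexp, integral_reflected_pow_mul_pow_mul_pow,
    integral_reflected_pow_mul_pow_mul_pow, integral_sq_sub_sq_pow_mul_pow,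
    integral_sq_sub_sq_pow_mul_pow, Finset.prod_div_distrib, Nat.add_sub_cancel]
  have hnum : ∏ j ∈ Finset.range (p + 1), (((2 * d + 2 : ℕ) : ℝ) + 1 + 2 * (j : ℝ)) =
      ∏ j ∈ Finset.range (p + 1), (2 * (d : ℝ) + (3 + 2 * (j : ℝ))) :=
    Finset.prod_congr rfl fun j _ => by push_cast; ring
  have hden : ∏ j ∈ Finset.range (p + 1), (((2 * d + 1 : ℕ) : ℝ) + 1 + 2 * (j : ℝ)) =
      ∏ j ∈ Finset.range (p + 1), (2 * (d : ℝ) + (2 + 2 * (j : ℝ))) :=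
    Finset.prod_congr rfl fun j _ => by push_cast; ring
  rw [hnum, hden]
  have hA : ∏ j ∈ Finset.range (p + 1), (2 * (d : ℝ) + (3 + 2 * (j : ℝ))) ≠ 0 :=
    Finset.prod_ne_zero_iff.2 fun j _ => by positivity
  have hB : ∏ j ∈ Finset.range (p + 1), (2 * (d : ℝ) + (2 + 2 * (j : ℝ))) ≠ 0 :=
    Finset.prod_ne_zero_iff.2 fun j _ => by positivity
  rw [← add_assoc (2 * (d : ℝ)) 2 ((p + 1 : ℕ) : ℝ)]
  have hL : 2 * (d : ℝ) + 2 + ((p + 1 : ℕ) : ℝ) ≠ 0 := by positivity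
  have hf : (p.factorial : ℝ) ≠ 0 := by positivity
  generalize 2 * (d : ℝ) + 2 + ((p + 1 : ℕ) : ℝ) = L at hL ⊢
  rw [show 2 * p + (2 * d + 2) + 1 = 2 * p + (2 * d + 1) + 1 + 1 by ring,
    pow_succ L (2 * p + (2 * d + 1) + 1)]
  field_simp
end

section
/- Let Q(t) = (3+t)^2 (3-t)^2 (9+t)^7 (15+t)^2 (21+t)^2. Then ∫_{-3}^{3} (3+t)·Q(t) dt = (243545402/59664033) · ∫_{-3}^{3} Q(t) dt and ∫_{-3}^{3} (3-t)·Q(t) dt = (114438796/59664033) · ∫_{-3}^{3} Q(t) dt, and the integral ∫_{-3}^{3} Q(t) dt is strictly positive. -/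
theorem integral_sum_const_mul_pow {n : ℕ} (c : Fin n → ℝ) (k : ℕ) (a b : ℝ) :
    ∫ t in a..b, ∑ i, c i * t ^ (k + i : ℕ) =
      ∑ i, c i * ((b ^ (k + i + 1 : ℕ) - a ^ (k + i + 1 : ℕ)) / ((k + i : ℕ) + 1)) := by
  rw [intervalIntegral.integral_finsetSum
    fun i _ => Continuous.intervalIntegrable (by fun_prop) a b]
  simp only [intervalIntegral.integral_const_mul, integral_pow]

/-- The coefficients of `(3 + t)^2 (3 - t)^2 (9 + t)^7 (15 + t)^2 (21 + t)^2`,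
in increasing degree. -/
def densityCoeff : Fin 16 → ℝ :=
  ![38441798021025, 38685872929095, 9004039584849, -3864949844985, -2582205388875,
    -470030335245, 38462924277, 35885855331, 8413006275, 1159726005, 106500339, 6724053,
    289575, 8145, 135, 1]

theorem pow_mul_density_eq_sum (k : ℕ) (t : ℝ) :
    t ^ k * ((3 + t)^2 * (3 - t)^2 * (9 + t)^7 * (15 + t)^2 * (21 + t)^2) =
      ∑ i, densityCoeff i * t ^ (k + i : ℕ) := by
  simp only [pow_add, mul_left_comm _ (t ^ k), ← Finset.mul_sum]
  congr 1
  simp [densityCoeff, Fin.sum_univ_succ]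
  ring

theorem integral_density :
    ∫ t in (-3:ℝ)..3, (3 + t)^2 * (3 - t)^2 * (9 + t)^7 * (15 + t)^2 * (21 + t)^2 =
      1442468759556096 / 7 := by
  have h := integral_sum_const_mul_pow densityCoeff 0 (-3) 3
  simp only [← pow_mul_density_eq_sum, pow_zero, one_mul] at h
  rw [h]
  simp [densityCoeff, Fin.sum_univ_succ]
  norm_num

theorem integral_id_mul_density :
    ∫ t in (-3:ℝ)..3, t * ((3 + t)^2 * (3 - t)^2 * (9 + t)^7 * (15 + t)^2 * (21 + t)^2) =
      14313923885365714944 / 17017 - 3 * (1442468759556096 / 7) := by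
  have h := integral_sum_const_mul_pow densityCoeff 1 (-3) 3
  simp only [← pow_mul_density_eq_sum, pow_one] at h
  rw [h]
  simp [densityCoeff, Fin.sum_univ_succ]
  norm_num

theorem stmt_19 (Q : ℝ → ℝ)
    (hQ : ∀ t : ℝ, Q t = (3 + t)^2 * (3 - t)^2 * (9 + t)^7 * (15 + t)^2 * (21 + t)^2) :
    (∫ t in (-3:ℝ)..3, (3 + t) * Q t) = (243545402/59664033) * (∫ t in (-3:ℝ)..3, Q t) ∧
    (∫ t in (-3:ℝ)..3, (3 - t) * Q t) = (114438796/59664033) * (∫ t in (-3:ℝ)..3, Q t) ∧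
    0 < ∫ t in (-3:ℝ)..3, Q t := by
  have hcont : Continuous Q := by
    rw [funext hQ]
    fun_prop
  have hmass : ∫ t in (-3:ℝ)..3, Q t = 1442468759556096 / 7 := by
    simpa only [hQ] using integral_density
  have hmoment : ∫ t in (-3:ℝ)..3, t * Q t =
      14313923885365714944 / 17017 - 3 * (1442468759556096 / 7) := by
    simpa only [hQ] using integral_id_mul_density
  have hconst : IntervalIntegrable (fun t => 3 * Q t) MeasureTheory.volume (-3) 3 :=
    Continuous.intervalIntegrable (by fun_prop) _ _
  have hlinear : IntervalIntegrable (fun t => t * Q t) MeasureTheory.volume (-3) 3 :=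
    Continuous.intervalIntegrable (by fun_prop) _ _
  simp only [add_mul, sub_mul]
  rw [intervalIntegral.integral_add hconst hlinear, intervalIntegral.integral_sub hconst hlinear,
    intervalIntegral.integral_const_mul, hmass, hmoment]
  norm_num
end
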